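/- Let P : ℝ^d → (0,1] be continuously differentiable, fix q ∈ [0,1], and let θ : I → ℝ^d (I an open interval) be a differentiable solution of the gradient flow θ'(t) = −∇ℓ_q(θ(t)) where ℓ_q = −log_q ∘ P. Then the success probability p(t) = P(θ(t)) is differentiable and satisfies p'(t) = P(θ(t))^{−q} · ‖∇P(θ(t))‖² = p(t)^{2−q} · ‖s(θ(t))‖², where s(θ) = ∇(log ∘ P)(θ) = ∇P(θ)/P(θ) is the score. In particular p'(t) ≥ 0 for all t. -/

import Mathlib

/-- The negated Tsallis q-logarithm `−log_q(u)`. -/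
noncomputable def negLogq (q u : ℝ) : ℝ :=
  if q = 1 then -Real.log u else -((u ^ (1 - q) - 1) / (1 - q))

theorem HasDerivAt.comp_hasGradientAt {E : Type*} [NormedAddCommGroup E] [InnerProductSpace ℝ E]
    [CompleteSpace E] {f : E → ℝ} {f' x : E} {g : ℝ → ℝ} {g' : ℝ}
    (hg : HasDerivAt g g' (f x)) (hf : HasGradientAt f f' x) :
    HasGradientAt (fun y => g (f y)) (g' • f') x := by
  rw [hasGradientAt_iff_hasFDerivAt] at hf ⊢
  rw [map_smul]
  exact hg.comp_hasFDerivAt x hf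

theorem hasDerivAt_negLogq (q : ℝ) {u : ℝ} (hu : 0 < u) :
    HasDerivAt (negLogq q) (-u ^ (-q)) u := by
  by_cases hq : q = 1
  · have h : negLogq q = fun u => -Real.log u := by
      funext v
      simp [negLogq, hq]
    rw [h, hq, Real.rpow_neg_one]
    exact (Real.hasDerivAt_log hu.ne').neg
  · have h : negLogq q = fun u => -((u ^ (1 - q) - 1) / (1 - q)) := by
      funext v
      simp [negLogq, hq]
    have hq' : 1 - q ≠ 0 := sub_ne_zero.mpr (Ne.symm hq)
    rw [h]
    refine (((Real.hasDerivAt_rpow_const (p := 1 - q) (Or.inl hu.ne')).sub_const 1).div_const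
      (1 - q)).neg.congr_deriv ?_
    rw [mul_div_cancel_left₀ _ hq', sub_sub_cancel_left]

/-- **success-probability dynamics.** Let `P : ℝ^d → (0,1]` be `C¹`,
fix `q ∈ [0,1]`, and let `θ` solve the gradient flow `θ' = −∇ℓ_q(θ)` with
`ℓ_q = −log_q ∘ P` on an open interval `(a,b)`.  Then `p(t) = P(θ(t))` is
differentiable with `p' = P(θ)^{−q}‖∇P(θ)‖² = p^{2−q}‖s(θ)‖²` where
`s = ∇(log ∘ P)` is the score; in particular `p' ≥ 0`. -/
theorem success_probability_dynamics
    {d : ℕ} (P : EuclideanSpace ℝ (Fin d) → ℝ)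
    (hP : ContDiff ℝ 1 P) (hP0 : ∀ x, 0 < P x) (hP1 : ∀ x, P x ≤ 1)
    {q : ℝ} (hq0 : 0 ≤ q) (hq1 : q ≤ 1)
    {a b : ℝ} (θ : ℝ → EuclideanSpace ℝ (Fin d))
    (hflow : ∀ t ∈ Set.Ioo a b,
      HasDerivAt θ (-(gradient (fun x => negLogq q (P x)) (θ t))) t) :
    ∀ t ∈ Set.Ioo a b,
      HasDerivAt (fun s => P (θ s))
        ((P (θ t)) ^ (-q) * ‖gradient P (θ t)‖ ^ 2) t ∧
      (P (θ t)) ^ (-q) * ‖gradient P (θ t)‖ ^ 2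
        = (P (θ t)) ^ (2 - q)
            * ‖gradient (fun x => Real.log (P x)) (θ t)‖ ^ 2 ∧
      0 ≤ (P (θ t)) ^ (-q) * ‖gradient P (θ t)‖ ^ 2 := by
  intro t ht
  have hgrad : HasGradientAt P (gradient P (θ t)) (θ t) :=
    (hP.differentiable one_ne_zero (θ t)).hasGradientAt
  have hpos := hP0 (θ t)
  have hloss := ((hasDerivAt_negLogq q hpos).comp_hasGradientAt hgrad).gradient
  have hscore := ((Real.hasDerivAt_log hpos.ne').comp_hasGradientAt hgrad).gradient
  refine ⟨?_, ?_, by positivity⟩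
  · have h := hflow t ht
    rw [hloss, neg_smul, neg_neg] at h
    refine (hgrad.hasFDerivAt.comp_hasDerivAt t h).congr_deriv ?_
    rw [InnerProductSpace.toDual_apply_apply, inner_smul_right, real_inner_self_eq_norm_sq]
  · rw [hscore, norm_smul, mul_pow, Real.norm_eq_abs, sq_abs, ← mul_assoc]
    congr 1
    rw [show 2 - q = -q + (2 : ℕ) by push_cast; ring, Real.rpow_add_natCast hpos.ne']
    field_simp
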